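/- The metapopulation equilibrium system always admits the following disease-free equilibrium: assuming Σ_k m_{ki} = 1 for every i, set S_{ii}* = Nr_i / (1 + g_i Σ_k m_{ki}/(d_H + r_{ik})), S_{ij}* = (g_i m_{ji}/(d_H + r_{ij})) S_{ii}* for j ≠ i, I_{ij}* = 0 and R_{ij}* = 0 for all i, j, Sm_i* = (s_L/d_m) L_i, and Im_i* = 0, where Nr_i > 0 is the prescribed resident population of node i. Then all equilibrium equations (a)–(h) are satisfied, i.e. all right-hand sides of the system vanish at these values. -/

import Mathlib

theorem metapop_DFE_exists {n : ℕ} (hn : 1 ≤ n)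
    (dH γH dm sL : ℝ) (hdH : 0 < dH) (hγH : 0 < γH) (hdm : 0 < dm) (hsL : 0 ≤ sL)
    (βH βm Lc g : Fin n → ℝ)
    (hβH : ∀ i, 0 < βH i) (hβm : ∀ i, 0 < βm i)
    (hLc : ∀ i, 0 ≤ Lc i) (hg : ∀ i, 0 ≤ g i)
    (m r : Fin n → Fin n → ℝ)
    (hm : ∀ j i, 0 ≤ m j i) (hmii : ∀ i, m i i = 0)
    (hr : ∀ i j, 0 ≤ r i j) (hrii : ∀ i, r i i = 0)
    (hmsum : ∀ i, (∑ k, m k i) = 1)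
    (NH : Fin n → ℝ) (hNH : ∀ i, 0 < NH i)
    (S I R : Fin n → Fin n → ℝ) (Sm Im : Fin n → ℝ)
    (hSdiag : ∀ i, S i i = NH i / (1 + g i * ∑ k, m k i / (dH + r i k)))
    (hSoff : ∀ i j, j ≠ i → S i j = g i * m j i / (dH + r i j) * S i i)
    (hI : ∀ i j, I i j = 0) (hR : ∀ i j, R i j = 0)
    (hSmdef : ∀ i, Sm i = sL / dm * Lc i) (hImdef : ∀ i, Im i = 0)
    (Np Nr : Fin n → ℝ)
    (hNp : ∀ i, Np i = ∑ j, (S j i + I j i + R j i))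
    (hNr : ∀ i, Nr i = ∑ j, (S i j + I i j + R i j)) :
    (∀ i, dH * (Nr i - S i i) - g i * S i i + (∑ k, r i k * S i k)
      - βH i * (Im i / Np i) * S i i = 0) ∧
    (∀ i j, j ≠ i → g i * m j i * S i i - dH * S i j - r i j * S i j
      - βH j * (Im j / Np j) * S i j = 0) ∧
    (∀ i, -(dH + γH + g i) * I i i + (∑ k, r i k * I i k)
      + βH i * (Im i / Np i) * S i i = 0) ∧
    (∀ i j, j ≠ i → g i * m j i * I i i - (dH + γH + r i j) * I i j
      + βH j * (Im j / Np j) * S i j = 0) ∧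
    (∀ i, γH * I i i - (dH + g i) * R i i + (∑ k, r i k * R i k) = 0) ∧
    (∀ i j, j ≠ i → g i * m j i * R i i + γH * I i j - (dH + r i j) * R i j = 0) ∧
    (∀ i, sL * Lc i - dm * Sm i - βm i * (Sm i / Np i) * (∑ k, I k i) = 0) ∧
    (∀ i, βm i * (Sm i / Np i) * (∑ k, I k i) - dm * Im i = 0) := by
  have hne : ∀ i k, dH + r i k ≠ 0 := fun i k => by have := hr i k; positivity
  have hoff : ∀ i j, j ≠ i → (dH + r i j) * S i j = g i * m j i * S i i := by
    intro i j hij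
    rw [hSoff i j hij]
    have := hne i j
    field_simp
  refine ⟨?_, ?_, ?_, ?_, ?_, ?_, ?_, ?_⟩
  · intro i
    have key : ∑ k, (dH + r i k) * S i k = g i * S i i + dH * S i i := by
      have h1 : ∀ k, (dH + r i k) * S i k
          = m k i * (g i * S i i) + (if k = i then dH * S i i else 0) := by
        intro k
        by_cases hk : k = i
        · subst hk
          simp [hmii, hrii]
        · rw [hoff i k hk, if_neg hk]
          ring
      rw [Finset.sum_congr rfl (fun k _ => h1 k), Finset.sum_add_distrib, ← Finset.sum_mul,
        hmsum]
      simp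
    have hN : Nr i = ∑ k, S i k := by
      rw [hNr]
      simp [hI, hR]
    simp only [add_mul, Finset.sum_add_distrib, ← Finset.mul_sum] at key
    rw [hN, hImdef, zero_div]
    linarith
  · intro i j hij
    have := hoff i j hij
    rw [hImdef, zero_div]
    linarith
  · intro i
    simp [hI, hImdef]
  · intro i j _
    simp [hI, hImdef]
  · intro i
    simp [hI, hR]
  · intro i j _
    simp [hI, hR]
  · intro i
    simp only [hI, hSmdef, Finset.sum_const_zero, mul_zero, sub_zero]
    field_simp
    ring
  · intro i
    simp [hI, hImdef]
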